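/- Fix L > 0, r > 0, θ ∈ [−1,1], ν = √(1 − θ²). Let I_x be a finite set of vectors x ∈ ℝⁿ with all entries nonzero, no entry in (−Lr, Lr), and (x − rZ(x))ᵀZ(x) = θ‖x − rZ(x)‖‖Z(x)‖. Let I_u ⊆ ℝ^m, I_d ⊆ ℝ^m and I_γ ⊆ ℝ be finite sets and ψ : I_d × I_x × I_u × I_γ → ℝ any function. Let G (an m×n matrix), g, f ∈ ℝ^m, h ∈ ℝⁿ, and scalars z, z̃ all have i.i.d. standard Gaussian entries, mutually independent. Define Ỹ(x,u,γ) = uᵀG(x − rZ(x)) + γ·uᵀG Z(x) + z·‖u‖‖x − rZ(x)‖ + |γ|·(θz + νz̃)·‖u‖‖Z(x)‖ and W̃(x,u,γ) = ‖x − rZ(x)‖·gᵀu − ‖u‖·hᵀ(x − rZ(x)) + γ‖Z(x)‖·(θg + νf)ᵀu − |γ|·‖u‖·hᵀZ(x). Then for every t ∈ ℝ: P[ min_{x ∈ I_x, d ∈ I_d} max_{u ∈ I_u, γ ∈ I_γ} (Ỹ(x,u,γ) + ψ(d,x,u,γ)) ≤ t ] ≤ P[ min_{x ∈ I_x, d ∈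 I_d} max_{u ∈ I_u, γ ∈ I_γ} (W̃(x,u,γ) + ψ(d,x,u,γ)) ≤ t ]. -/

import Mathlib

open MeasureTheory ProbabilityTheory Real
open scoped ENNReal NNReal

/-- One-bit quantization `Z(v) = L · sign(v)` applied entrywise. -/
noncomputable def Zv {n : ℕ} (L : ℝ) (x : Fin n → ℝ) : Fin n → ℝ :=
  fun i => L * Real.sign (x i)

/-- Euclidean dot product. -/
noncomputable def dotp {k : ℕ} (a b : Fin k → ℝ) : ℝ := ∑ i, a i * b i

/-- Euclidean norm. -/
noncomputable def nrm {k : ℕ} (a : Fin k → ℝ) : ℝ := Real.sqrt (∑ i, (a i) ^ 2)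

/-- `x − r Z(x)`. -/
noncomputable def xr {n : ℕ} (L r : ℝ) (x : Fin n → ℝ) : Fin n → ℝ :=
  fun i => x i - r * (L * Real.sign (x i))

/-- Matrix–vector product. -/
noncomputable def mulV {m n : ℕ} (H : Fin m → Fin n → ℝ) (x : Fin n → ℝ) : Fin m → ℝ :=
  fun k => ∑ i, H k i * x i

/-- Law of an `m × n` random matrix with i.i.d. standard Gaussian entries. -/
noncomputable def stdMat (m n : ℕ) : Measure (Fin m → Fin n → ℝ) :=
  Measure.pi fun _ : Fin m => Measure.pi fun _ : Fin n => gaussianReal 0 1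

/-- Law of a vector of `k` i.i.d. standard Gaussian entries. -/
noncomputable def stdVec (k : ℕ) : Measure (Fin k → ℝ) :=
  Measure.pi fun _ : Fin k => gaussianReal 0 1

section GaussianComparison

set_option maxSynthPendingDepth 3

/-- `F` is of class `C³` and its derivatives of order at most three are bounded. -/
def HasBddDerivs {E : Type*} [NormedAddCommGroup E] [NormedSpace ℝ E] (F : E → ℝ) : Prop :=
  ContDiff ℝ 3 F ∧ ∀ i : ℕ, i ≤ 3 → ∃ C, ∀ x, ‖iteratedFDeriv ℝ i F x‖ ≤ C

namespace HasBddDerivs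

variable {E E' : Type*} [NormedAddCommGroup E] [NormedSpace ℝ E] [NormedAddCommGroup E']
  [NormedSpace ℝ E'] {F G : E → ℝ}

lemma const (c : ℝ) : HasBddDerivs (fun _ : E => c) := by
  refine ⟨contDiff_const, fun i _ => ?_⟩
  rcases Nat.eq_zero_or_pos i with rfl | hi
  · exact ⟨‖c‖, fun x => by simp⟩
  · exact ⟨0, fun x => by rw [iteratedFDeriv_const_of_ne hi.ne']; simp⟩

lemma sub (hF : HasBddDerivs F) (hG : HasBddDerivs G) : HasBddDerivs (fun x => F x - G x) := by
  refine ⟨hF.1.sub hG.1, fun i hi => ?_⟩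
  obtain ⟨C, hC⟩ := hF.2 i hi
  obtain ⟨C', hC'⟩ := hG.2 i hi
  refine ⟨C + C', fun x => ?_⟩
  have h : iteratedFDeriv ℝ i (fun x => F x - G x) x =
      iteratedFDeriv ℝ i F x - iteratedFDeriv ℝ i G x :=
    iteratedFDeriv_sub_apply ((hF.1.of_le (by exact_mod_cast hi)).contDiffAt)
      ((hG.1.of_le (by exact_mod_cast hi)).contDiffAt)
  rw [h]
  exact (norm_sub_le _ _).trans (add_le_add (hC x) (hC' x))

lemma mul (hF : HasBddDerivs F) (hG : HasBddDerivs G) : HasBddDerivs (fun x => F x * G x) := by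
  refine ⟨hF.1.mul hG.1, fun i hi => ?_⟩
  choose! C hC using hF.2
  choose! C' hC' using hG.2
  refine ⟨∑ j ∈ Finset.range (i + 1), (i.choose j : ℝ) * C j * C' (i - j), fun x => ?_⟩
  refine (norm_iteratedFDeriv_mul_le hF.1 hG.1 x (by exact_mod_cast hi)).trans ?_
  refine Finset.sum_le_sum fun j hj => ?_
  have hj' : j ≤ 3 := by have := Finset.mem_range.1 hj; omega
  have h0 : 0 ≤ C j := (norm_nonneg _).trans (hC j hj' x)
  gcongr
  · exact hC j hj' x
  · exact hC' (i - j) (by omega) x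

lemma prod {κ : Type*} (s : Finset κ) {f : κ → E → ℝ} (hf : ∀ k ∈ s, HasBddDerivs (f k)) :
    HasBddDerivs (fun x => ∏ k ∈ s, f k x) := by
  classical
  induction s using Finset.induction_on with
  | empty => simpa using const 1
  | insert a s ha ih =>
    simp only [Finset.prod_insert ha]
    exact (hf a (by simp)).mul (ih fun k hk => hf k (by simp [hk]))

lemma comp_clm (hF : HasBddDerivs F) (T : E' →L[ℝ] E) : HasBddDerivs (fun x => F (T x)) := by
  refine ⟨hF.1.comp T.contDiff, fun i hi => ?_⟩
  obtain ⟨C, hC⟩ := hF.2 i hi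
  refine ⟨C * ∏ _j : Fin i, ‖T‖, fun x => ?_⟩
  have h := T.iteratedFDeriv_comp_right hF.1 x (i := i) (by exact_mod_cast hi)
  change ‖iteratedFDeriv ℝ i (F ∘ T) x‖ ≤ _
  rw [h]
  refine (ContinuousMultilinearMap.norm_compContinuousLinearMap_le _ _).trans ?_
  gcongr
  exact hC _

lemma bounded (hF : HasBddDerivs F) : ∃ C, ∀ x, |F x| ≤ C := by
  obtain ⟨C, hC⟩ := hF.2 0 (by omega)
  exact ⟨C, fun x => by simpa using hC x⟩

lemma smoothStep (a b : ℝ) : HasBddDerivs (fun t : ℝ => smoothTransition (a * t - b)) := by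
  rcases eq_or_ne a 0 with rfl | ha
  · simpa using const (E := ℝ) (smoothTransition (-b))
  have hsm : ContDiff ℝ 3 (fun t : ℝ => smoothTransition (a * t - b)) :=
    Real.smoothTransition.contDiff.comp (n := 3) (g := smoothTransition)
      ((contDiff_const.mul contDiff_id).sub contDiff_const)
  have hsup : HasCompactSupport (fderiv ℝ (fun t : ℝ => smoothTransition (a * t - b))) := by
    refine HasCompactSupport.intro (isCompact_Icc (a := min (b / a) ((b + 1) / a))
      (b := max (b / a) ((b + 1) / a))) fun x hx => ?_
    have key : a * x - b < 0 ∨ 1 < a * x - b := by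
      by_contra! h
      apply hx
      rcases lt_or_gt_of_ne ha with h' | h'
      · refine ⟨min_le_iff.2 (Or.inr ?_), le_max_iff.2 (Or.inl ?_)⟩
        · rw [div_le_iff_of_neg h']; linarith
        · rw [le_div_iff_of_neg h']; linarith
      · refine ⟨min_le_iff.2 (Or.inl ?_), le_max_iff.2 (Or.inr ?_)⟩
        · rw [div_le_iff₀ h']; linarith
        · rw [le_div_iff₀ h']; linarith
    have hc : Continuous fun t : ℝ => a * t - b := by fun_prop
    have : ∃ c : ℝ, (fun t : ℝ => smoothTransition (a * t - b)) =ᶠ[nhds x] fun _ => c := by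
      rcases key with h | h
      · exact ⟨0, (hc.continuousAt.eventually (gt_mem_nhds h)).mono fun t ht =>
          smoothTransition.zero_of_nonpos ht.le⟩
      · exact ⟨1, (hc.continuousAt.eventually (lt_mem_nhds h)).mono fun t ht =>
          smoothTransition.one_of_one_le ht.le⟩
    obtain ⟨c, hc⟩ := this
    rw [hc.fderiv_eq]
    simp
  refine ⟨hsm, fun i hi => ?_⟩
  rcases i with _ | i
  · exact ⟨1, fun x => by
      simpa [abs_of_nonneg (smoothTransition.nonneg _)] using smoothTransition.le_one _⟩
  · have hcont : Continuous
        (iteratedFDeriv ℝ i (fderiv ℝ (fun t : ℝ => smoothTransition (a * t - b)))) := by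
      refine (hsm.fderiv_right (m := i) ?_).continuous_iteratedFDeriv (m := i) le_rfl
      exact_mod_cast hi
    obtain ⟨C, hC⟩ := hcont.bounded_above_of_compact_support (hsup.iteratedFDeriv i)
    exact ⟨C, fun x => by rw [← norm_iteratedFDeriv_fderiv]; exact hC x⟩

lemma hasDerivAt_clm_line {f : E → E →L[ℝ] ℝ} {f' : E →L[ℝ] E →L[ℝ] ℝ} {v a : E} {s : ℝ}
    (hf : HasFDerivAt f f' (v + s • a)) (b : E) :
    HasDerivAt (fun s : ℝ => f (v + s • a) b) (f' a b) s := by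
  have hline : HasDerivAt (fun s : ℝ => v + s • a) a s := by
    simpa using ((hasDerivAt_id s).smul_const a).const_add v
  have h : HasDerivAt (fun s : ℝ => f (v + s • a)) (f' a) s := hf.comp_hasDerivAt s hline
  exact ((ContinuousLinearMap.apply ℝ ℝ b).hasFDerivAt (x := f (v + s • a))).comp_hasDerivAt s h

/-- Second-order Taylor expansion with a uniform cubic remainder. -/
lemma taylor (hF : HasBddDerivs F) : ∃ C, 0 ≤ C ∧ ∀ v y,
    |F (v + y) - F v - fderiv ℝ F v y - 1 / 2 * fderiv ℝ (fderiv ℝ F) v y y| ≤ C * ‖y‖ ^ 3 := by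
  obtain ⟨C, hC⟩ := hF.2 3 le_rfl
  have hC0 : 0 ≤ C := (norm_nonneg _).trans (hC 0)
  have h1 : ContDiff ℝ 2 (fderiv ℝ F) := hF.1.fderiv_right (by norm_num)
  have h2 : ContDiff ℝ 1 (fderiv ℝ (fderiv ℝ F)) := h1.fderiv_right (by norm_num)
  have hb : ∀ x, ‖fderiv ℝ (fderiv ℝ (fderiv ℝ F)) x‖ ≤ C := fun x => by
    have := hC x
    rwa [← norm_iteratedFDeriv_fderiv, ← norm_iteratedFDeriv_fderiv,
      ← norm_iteratedFDeriv_fderiv, norm_iteratedFDeriv_zero] at this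
  have hlip : ∀ x x', ‖fderiv ℝ (fderiv ℝ F) x' - fderiv ℝ (fderiv ℝ F) x‖ ≤ C * ‖x' - x‖ :=
    fun x x' => convex_univ.norm_image_sub_le_of_norm_fderiv_le
      (fun z _ => (h2.differentiable one_ne_zero) z) (fun z _ => hb z) trivial trivial
  have dF : Differentiable ℝ F := hF.1.differentiable (by norm_num)
  have dF1 : Differentiable ℝ (fderiv ℝ F) := h1.differentiable (by norm_num)
  have mvt : ∀ (g g' : ℝ → ℝ) (K : ℝ), g 0 = 0 → (∀ s, HasDerivAt g (g' s) s) →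
      (∀ s ∈ Set.Icc (0 : ℝ) 1, |g' s| ≤ K) → ∀ s ∈ Set.Icc (0 : ℝ) 1, |g s| ≤ K := by
    intro g g' K h0 hg hK s hs
    have := (convex_Icc (0 : ℝ) 1).norm_image_sub_le_of_norm_hasDerivWithin_le
      (fun z _ => (hg z).hasDerivWithinAt) hK (Set.left_mem_Icc.2 zero_le_one) hs
    rw [h0, sub_zero, sub_zero, Real.norm_eq_abs, Real.norm_eq_abs, abs_of_nonneg hs.1] at this
    refine this.trans ?_
    have hK0 : 0 ≤ K := (abs_nonneg _).trans (hK s hs)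
    nlinarith [hs.2]
  refine ⟨C, hC0, fun v y => ?_⟩
  have hline : ∀ s : ℝ, HasDerivAt (fun s : ℝ => v + s • y) y s := fun s => by
    simpa using ((hasDerivAt_id s).smul_const y).const_add v
  have step1 : ∀ s ∈ Set.Icc (0 : ℝ) 1,
      |fderiv ℝ F (v + s • y) y - fderiv ℝ F v y - s * fderiv ℝ (fderiv ℝ F) v y y| ≤
        C * ‖y‖ ^ 3 := by
    refine mvt _ (fun s => fderiv ℝ (fderiv ℝ F) (v + s • y) y y -
      fderiv ℝ (fderiv ℝ F) v y y) _ (by simp) (fun s => ?_) fun s hs => ?_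
    · have := hasDerivAt_clm_line (dF1 (v + s • y)).hasFDerivAt y
      have h3 := (this.sub_const (fderiv ℝ F v y)).sub
        ((hasDerivAt_id s).mul_const (fderiv ℝ (fderiv ℝ F) v y y))
      exact h3.congr_deriv (by simp)
    · calc |fderiv ℝ (fderiv ℝ F) (v + s • y) y y - fderiv ℝ (fderiv ℝ F) v y y|
          = ‖(fderiv ℝ (fderiv ℝ F) (v + s • y) - fderiv ℝ (fderiv ℝ F) v) y y‖ := by
            simp
        _ ≤ ‖fderiv ℝ (fderiv ℝ F) (v + s • y) - fderiv ℝ (fderiv ℝ F) v‖ * ‖y‖ * ‖y‖ :=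
            ContinuousLinearMap.le_opNorm₂ _ _ _
        _ ≤ (C * ‖y‖) * ‖y‖ * ‖y‖ := by
            gcongr
            refine (hlip _ _).trans ?_
            gcongr
            rw [add_sub_cancel_left, norm_smul, Real.norm_eq_abs, abs_of_nonneg hs.1]
            exact mul_le_of_le_one_left (norm_nonneg _) hs.2
        _ = C * ‖y‖ ^ 3 := by ring
  have step2 := mvt (fun s => F (v + s • y) - F v - s * fderiv ℝ F v y -
      s ^ 2 / 2 * fderiv ℝ (fderiv ℝ F) v y y) (fun s => fderiv ℝ F (v + s • y) y -
        fderiv ℝ F v y - s * fderiv ℝ (fderiv ℝ F) v y y) _ (by simp) (fun s => ?_) step1 1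
      (Set.right_mem_Icc.2 zero_le_one)
  · simpa using step2
  · have h3 := ((((dF (v + s • y)).hasFDerivAt.comp_hasDerivAt s (hline s)).sub_const (F v)).sub
      ((hasDerivAt_id s).mul_const (fderiv ℝ F v y))).sub
      ((((hasDerivAt_id s).pow 2).div_const 2).mul_const (fderiv ℝ (fderiv ℝ F) v y y))
    exact h3.congr_deriv (by simp)

lemma fderiv_fderiv_nonneg (hF : HasBddDerivs F) (a b v : E)
    (h : ∀ w : E, ∀ s r : ℝ, 0 ≤ s → 0 ≤ r →
      F (w + s • a) + F (w + r • b) ≤ F (w + s • a + r • b) + F w) :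
    0 ≤ fderiv ℝ (fderiv ℝ F) v a b := by
  have dF : Differentiable ℝ F := hF.1.differentiable (by norm_num)
  have dF1 : Differentiable ℝ (fderiv ℝ F) :=
    (hF.1.fderiv_right (m := 2) (by norm_num)).differentiable (by norm_num)
  have right : ∀ (g : ℝ → ℝ) (g' : ℝ), HasDerivAt g g' 0 → (∀ s, 0 ≤ s → g 0 ≤ g s) →
      0 ≤ g' := by
    intro g g' hg hs
    refine ge_of_tendsto
      ((hasDerivWithinAt_iff_tendsto_slope' Set.self_notMem_Ioi).1
        (hg.hasDerivWithinAt (s := Set.Ioi 0))) ?_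
    filter_upwards [self_mem_nhdsWithin] with s hs'
    rw [slope_def_field]
    have h1 : (0 : ℝ) < s := hs'
    exact div_nonneg (sub_nonneg.2 (hs s h1.le)) (by linarith)
  have hline : ∀ (w c : E), HasDerivAt (fun s : ℝ => w + s • c) c 0 := fun w c => by
    simpa using ((hasDerivAt_id (0 : ℝ)).smul_const c).const_add w
  have hd : ∀ w c : E, HasDerivAt (fun s : ℝ => F (w + s • c)) (fderiv ℝ F w c) 0 := fun w c => by
    have h0 : HasFDerivAt F (fderiv ℝ F w) (w + (0 : ℝ) • c) := by
      simpa using (dF w).hasFDerivAt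
    exact h0.comp_hasDerivAt 0 (hline w c)
  refine right (fun s => fderiv ℝ F (v + s • a) b) _ ?_ fun s hs => ?_
  · have h0 : HasFDerivAt (fderiv ℝ F) (fderiv ℝ (fderiv ℝ F) v) (v + (0 : ℝ) • a) := by
      simpa using (dF1 v).hasFDerivAt
    exact hasDerivAt_clm_line h0 b
  · have := right (fun r => F (v + s • a + r • b) - F (v + r • b)) _
      ((hd (v + s • a) b).sub (hd v b)) fun r hr => by
        have := h v s r hs hr
        simp only [zero_smul, add_zero]
        linarith
    simpa using this

end HasBddDerivs

lemma bilin_eq_sum_single {ι : Type*} [Fintype ι] [DecidableEq ι]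
    (B : (ι → ℝ) →L[ℝ] (ι → ℝ) →L[ℝ] ℝ) (y : ι → ℝ) :
    B y y = ∑ p, ∑ q, B (Pi.single p 1) (Pi.single q 1) * (y p * y q) := by
  have hy : y = ∑ p, y p • (Pi.single p 1 : ι → ℝ) := by
    simpa [Pi.single_apply, eq_comm] using pi_eq_sum_univ' y
  conv_lhs => rw [hy]
  simp only [map_sum, map_smul, _root_.sum_apply, _root_.smul_apply,
    smul_eq_mul, Finset.mul_sum]
  rw [Finset.sum_comm]
  exact Finset.sum_congr rfl fun p _ => Finset.sum_congr rfl fun q _ => by ring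

namespace ProbabilityTheory.IsGaussian

section

variable {E : Type*} [NormedAddCommGroup E] [NormedSpace ℝ E] [CompleteSpace E]
  [SecondCountableTopology E] [MeasurableSpace E] [BorelSpace E] {μ : Measure E} [IsGaussian μ]

/-- Stability of centered Gaussian measures. -/
lemma integral_sqrt_add_smul (hμ : μ[id] = 0) {a b : ℝ} (ha : 0 ≤ a) (hb : 0 ≤ b) {G : E → ℝ}
    (hG : Continuous G) :
    ∫ y, G (√(a + b) • y) ∂μ = ∫ z, G (√a • z.1 + √b • z.2) ∂(μ.prod μ) := by
  rcases (add_nonneg ha hb).eq_or_lt with h0 | h0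
  · obtain rfl : a = 0 := by linarith
    obtain rfl : b = 0 := by linarith
    simp
  set c := √a / √(a + b) with hc
  have hpos : 0 < √(a + b) := sqrt_pos.2 h0
  have hc0 : 0 ≤ c := by positivity
  have hc1 : c ≤ 1 := (div_le_one hpos).2 (sqrt_le_sqrt (by linarith))
  have hcos : √(a + b) * cos (arccos c) = √a := by
    rw [cos_arccos (by linarith) hc1, hc]
    field_simp
  have hsin : √(a + b) * sin (arccos c) = √b := by
    rw [sin_arccos, ← sqrt_mul h0.le]
    congr 1
    rw [hc, div_pow, sq_sqrt ha, sq_sqrt h0.le]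
    field_simp
    ring
  have h1 : ∫ y, G (√(a + b) • y) ∂μ = ∫ z, G (√(a + b) • z.1) ∂(μ.prod μ) :=
    (integral_fun_fst (μ := μ) (ν := μ) (fun y => G (√(a + b) • y))).symm ▸ by simp
  rw [h1, ← map_rotation_eq_self hμ (arccos c), integral_map (by fun_prop)
    (Continuous.aestronglyMeasurable (by fun_prop)), map_rotation_eq_self hμ (arccos c)]
  simp only [ContinuousLinearMap.rotation_apply, smul_add, smul_smul, hcos, hsin]

lemma integral_taylor (hμ : μ[id] = 0) {F : E → ℝ} (hF : HasBddDerivs F) :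
    ∃ K, 0 ≤ K ∧ ∀ (v : E) (ε : ℝ), 0 ≤ ε →
      |∫ y, F (v + ε • y) ∂μ - F v - ε ^ 2 / 2 * ∫ y, fderiv ℝ (fderiv ℝ F) v y y ∂μ| ≤
        K * ε ^ 3 := by
  obtain ⟨C, hC0, hC⟩ := hF.taylor
  obtain ⟨M, hM⟩ := hF.bounded
  have hFc : Continuous F := hF.1.continuous
  have h3 : Integrable (fun y : E => ‖y‖ ^ 3) μ := by
    simpa using (memLp_id μ 3 (by simp)).integrable_norm_pow (p := 3) (by norm_num)
  have h2 : Integrable (fun y : E => ‖y‖ ^ 2) μ := by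
    simpa using (memLp_id μ 2 (by simp)).integrable_norm_pow (p := 2) (by norm_num)
  refine ⟨C * ∫ y, ‖y‖ ^ 3 ∂μ, by positivity, fun v ε hε => ?_⟩
  have i1 : Integrable (fun y => F (v + ε • y)) μ :=
    Integrable.of_bound (Continuous.aestronglyMeasurable (by fun_prop)) M
      (ae_of_all _ fun y => hM _)
  have i2 : Integrable (fun y => fderiv ℝ F v y) μ := integrable_dual μ _
  have i3 : Integrable (fun y => fderiv ℝ (fderiv ℝ F) v y y) μ := by
    refine (h2.const_mul ‖fderiv ℝ (fderiv ℝ F) v‖).mono'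
      (Continuous.aestronglyMeasurable (by fun_prop)) (ae_of_all _ fun y => ?_)
    refine (ContinuousLinearMap.le_opNorm₂ _ _ _).trans (le_of_eq (by ring))
  have e2 : ∫ y, fderiv ℝ F v y ∂μ = 0 := by
    have hμ' : ∫ x, x ∂μ = 0 := hμ
    rw [integral_dual, hμ', map_zero]
  have key : ∫ y, F (v + ε • y) ∂μ - F v - ε ^ 2 / 2 * ∫ y, fderiv ℝ (fderiv ℝ F) v y y ∂μ =
      ∫ y, (F (v + ε • y) - F v - ε * fderiv ℝ F v y -
        ε ^ 2 / 2 * fderiv ℝ (fderiv ℝ F) v y y) ∂μ := by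
    have j1 : Integrable (fun y => F (v + ε • y) - F v) μ := i1.sub (integrable_const _)
    have j2 : Integrable (fun y => F (v + ε • y) - F v - ε * fderiv ℝ F v y) μ :=
      j1.sub (i2.const_mul _)
    rw [integral_sub j2 (i3.const_mul _), integral_sub j1 (i2.const_mul _),
      integral_sub i1 (integrable_const _), integral_const_mul, integral_const_mul, e2]
    simp
  rw [key, ← Real.norm_eq_abs]
  refine (norm_integral_le_integral_norm _).trans ?_
  rw [mul_right_comm, mul_assoc, ← integral_const_mul, ← integral_const_mul]
  refine integral_mono_of_nonneg (ae_of_all _ fun _ => norm_nonneg _)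
    ((h3.const_mul _).const_mul _) (ae_of_all _ fun y => ?_)
  have := hC v (ε • y)
  rw [norm_smul, Real.norm_eq_abs, abs_of_nonneg hε] at this
  simp only [map_smul, _root_.smul_apply, smul_eq_mul] at this
  simp only [Real.norm_eq_abs]
  rw [show C * (ε ^ 3 * ‖y‖ ^ 3) = C * (ε * ‖y‖) ^ 3 by ring,
    show ε ^ 2 / 2 * fderiv ℝ (fderiv ℝ F) v y y =
      1 / 2 * (ε * (ε * fderiv ℝ (fderiv ℝ F) v y y)) by ring]
  exact this

/-- The interpolation estimate behind Gaussian comparison: if replacing `ν` by `μ` increases the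
second-order term of `F` at every point, then it increases the integral of `F`. -/
lemma integral_le_of_integral_fderiv_fderiv_le {ν : Measure E} [IsGaussian ν] (hμ : μ[id] = 0)
    (hν : ν[id] = 0) {F : E → ℝ} (hF : HasBddDerivs F)
    (h : ∀ v, ∫ y, fderiv ℝ (fderiv ℝ F) v y y ∂ν ≤ ∫ y, fderiv ℝ (fderiv ℝ F) v y y ∂μ) :
    ∫ y, F y ∂ν ≤ ∫ y, F y ∂μ := by
  obtain ⟨K₁, hK₁, hμK⟩ := integral_taylor hμ hF
  obtain ⟨K₂, hK₂, hνK⟩ := integral_taylor hν hF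
  obtain ⟨M, hM⟩ := hF.bounded
  have hFc : Continuous F := hF.1.continuous
  have integrable_inner : ∀ {X : Type _} [TopologicalSpace X] [SecondCountableTopology X]
      [MeasurableSpace X]
      [OpensMeasurableSpace X] (ρ : Measure X) [IsFiniteMeasure ρ] (g : X → E),
      Continuous g → Integrable (fun x => F (g x)) ρ := fun ρ _ g hg =>
    Integrable.of_bound (hFc.comp hg).aestronglyMeasurable M (ae_of_all _ fun y => hM _)
  set K := K₁ + K₂ with hK
  have hstep : ∀ (v : E) (ε : ℝ), 0 ≤ ε →
      ∫ y, F (v + ε • y) ∂ν - K * ε ^ 3 ≤ ∫ y, F (v + ε • y) ∂μ := fun v ε hε => by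
    have h1 := abs_le.1 (hμK v ε hε)
    have h2 := abs_le.1 (hνK v ε hε)
    have h3 := mul_le_mul_of_nonneg_left (h v) (show 0 ≤ ε ^ 2 / 2 by positivity)
    rw [hK, add_mul]
    linarith [h1.1, h2.2]
  set φ : ℝ → ℝ := fun s => ∫ z, F (√s • z.1 + √(1 - s) • z.2) ∂(μ.prod ν) with hφ
  have hinc : ∀ s δ : ℝ, 0 ≤ s → 0 ≤ δ → s + δ ≤ 1 → φ s - K * √δ ^ 3 ≤ φ (s + δ) := by
    intro s δ hs hδ hsδ
    set r := 1 - s - δ with hr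
    have hr0 : 0 ≤ r := by linarith
    have e1 : φ (s + δ) = ∫ w, ∫ y, ∫ y', F ((√s • y + √r • w) + √δ • y') ∂μ ∂μ ∂ν := by
      rw [hφ]
      simp only
      rw [integral_prod_symm _ (integrable_inner _ _ (by fun_prop))]
      refine integral_congr_ae (ae_of_all _ fun w => ?_)
      simp only
      rw [show 1 - (s + δ) = r by rw [hr]; ring,
        integral_sqrt_add_smul hμ hs hδ (G := fun x => F (x + √r • w)) (by fun_prop),
        integral_prod _ (integrable_inner _ _ (by fun_prop))]
      simp only [add_right_comm]
    have e2 : φ s = ∫ y, ∫ w, ∫ w', F ((√s • y + √r • w) + √δ • w') ∂ν ∂ν ∂μ := by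
      rw [hφ]
      simp only
      rw [integral_prod _ (integrable_inner _ _ (by fun_prop))]
      refine integral_congr_ae (ae_of_all _ fun y => ?_)
      simp only
      rw [show 1 - s = r + δ by rw [hr]; ring,
        integral_sqrt_add_smul hν hr0 hδ (G := fun x => F (√s • y + x)) (by fun_prop),
        integral_prod _ (integrable_inner _ _ (by fun_prop))]
      simp only [add_assoc]
    have hI : ∀ (ρ : Measure E) [IsProbabilityMeasure ρ], Integrable
        (fun z : E × E => ∫ y', F ((√s • z.1 + √r • z.2) + √δ • y') ∂ρ) (μ.prod ν) := by
      intro ρ _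
      have := (integrable_inner ((μ.prod ν).prod ρ)
        (fun z => (√s • z.1.1 + √r • z.1.2) + √δ • z.2) (by fun_prop)).integral_prod_left
      exact this
    have e1' : φ (s + δ) =
        ∫ z, ∫ y', F ((√s • z.1 + √r • z.2) + √δ • y') ∂μ ∂(μ.prod ν) := by
      rw [e1, integral_prod_symm _ (hI μ)]
    have e2' : φ s = ∫ z, ∫ y', F ((√s • z.1 + √r • z.2) + √δ • y') ∂ν ∂(μ.prod ν) := by
      rw [e2, integral_prod _ (hI ν)]
    have hle := integral_mono ((hI ν).sub (integrable_const (K * √δ ^ 3))) (hI μ)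
      fun z => hstep (√s • z.1 + √r • z.2) (√δ) (sqrt_nonneg _)
    simp only [Pi.sub_apply] at hle
    rw [integral_sub (hI ν) (integrable_const _), ← e1', ← e2'] at hle
    simpa using hle
  have hφ1 : φ 1 = ∫ y, F y ∂μ := by
    simp only [hφ, sqrt_one, one_smul, sub_self, sqrt_zero, zero_smul, add_zero]
    rw [integral_fun_fst]
    simp
  have hφ0 : φ 0 = ∫ y, F y ∂ν := by
    simp only [hφ, sqrt_one, one_smul, sub_zero, sqrt_zero, zero_smul, zero_add]
    rw [integral_fun_snd]
    simp
  rw [← hφ0, ← hφ1]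
  have hN : ∀ N : ℕ, φ 0 - K * √(1 / ((N : ℝ) + 1)) ≤ φ 1 := by
    intro N
    set δ : ℝ := 1 / ((N : ℝ) + 1) with hδ
    have hδ0 : 0 < δ := by positivity
    have hNδ : ((N : ℝ) + 1) * δ = 1 := by rw [hδ]; field_simp
    have hind : ∀ k : ℕ, k ≤ N + 1 → φ 0 - k * (K * √δ ^ 3) ≤ φ (k * δ) := by
      intro k
      induction k with
      | zero => intro _; simp
      | succ k ih =>
        intro hk
        have h1 := ih (by omega)
        have hk' : (k : ℝ) + 1 ≤ N + 1 := by exact_mod_cast hk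
        have h2 := hinc (k * δ) δ (by positivity) hδ0.le (by nlinarith)
        rw [show (k : ℝ) * δ + δ = ((k + 1 : ℕ) : ℝ) * δ by push_cast; ring] at h2
        push_cast at h2 ⊢
        linarith
    have h1 := hind (N + 1) le_rfl
    push_cast at h1
    rw [hNδ] at h1
    have h2 : ((N : ℝ) + 1) * (K * √δ ^ 3) = K * √δ := by
      have : √δ ^ 3 = δ * √δ := by rw [pow_succ, sq_sqrt hδ0.le]
      rw [this, show ((N : ℝ) + 1) * (K * (δ * √δ)) = (((N : ℝ) + 1) * δ) * (K * √δ) by ring,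
        hNδ, one_mul]
    rwa [h2] at h1
  have hlim : Filter.Tendsto (fun N : ℕ => φ 0 - K * √(1 / ((N : ℝ) + 1))) Filter.atTop
      (nhds (φ 0 - K * √0)) :=
    ((continuous_sqrt.tendsto 0).comp tendsto_one_div_add_atTop_nhds_zero_nat).const_mul K
      |>.const_sub _
  have := le_of_tendsto' hlim hN
  simpa using this

end

end ProbabilityTheory.IsGaussian

section Gordon

variable {I J : Type*} [Fintype I] [Fintype J] [DecidableEq I] [DecidableEq J]

omit [Fintype J] in
lemma prod_supermodular_of_rows {f : I → (I × J → ℝ) → ℝ} (h0 : ∀ i y, 0 ≤ f i y)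
    (hmono : ∀ i, Monotone (f i)) (hrow : ∀ i y y', (∀ j, y (i, j) = y' (i, j)) → f i y = f i y')
    {p q : I × J} (hpq : p.1 ≠ q.1) (w : I × J → ℝ) {s r : ℝ} (hs : 0 ≤ s) (hr : 0 ≤ r) :
    ∏ i, f i (w + s • Pi.single p 1) + ∏ i, f i (w + r • Pi.single q 1) ≤
      ∏ i, f i (w + s • Pi.single p 1 + r • Pi.single q 1) + ∏ i, f i w := by
  have hoff : ∀ (i : I) (z : I × J → ℝ) (c : ℝ) (p : I × J), i ≠ p.1 →
      f i (z + c • Pi.single p 1) = f i z := fun i z c p hi =>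
    hrow i _ _ fun j => by
      have : (i, j) ≠ p := fun h => hi (by rw [← h])
      simp [this]
  have hup : ∀ (i : I) (c : ℝ) (p : I × J), 0 ≤ c → f i w ≤ f i (w + c • Pi.single p 1) :=
    fun i c p hc => hmono i (le_add_of_nonneg_right
      (smul_nonneg hc (Pi.single_nonneg.2 zero_le_one)))
  have hsplit : ∀ z, ∏ i, f i z =
      f p.1 z * (f q.1 z * ∏ i ∈ (Finset.univ.erase p.1).erase q.1, f i z) := fun z => by
    rw [Finset.mul_prod_erase _ (fun i => f i z) (by simp [hpq.symm]),
      Finset.mul_prod_erase _ (fun i => f i z) (by simp)]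
  have hrest : ∀ (z : I × J → ℝ) (c : ℝ) (p' : I × J), (p'.1 = p.1 ∨ p'.1 = q.1) →
      ∏ i ∈ (Finset.univ.erase p.1).erase q.1, f i (z + c • Pi.single p' 1) =
        ∏ i ∈ (Finset.univ.erase p.1).erase q.1, f i z := fun z c p' hp' =>
    Finset.prod_congr rfl fun i hi => hoff i z c p' (by
      simp only [Finset.mem_erase, Finset.mem_univ, and_true] at hi
      rcases hp' with h | h <;> rw [h]
      exacts [hi.2, hi.1])
  rw [hsplit, hsplit, hsplit, hsplit, hrest _ r q (Or.inr rfl), hrest _ s p (Or.inl rfl),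
    hrest _ r q (Or.inr rfl), hoff p.1 _ r q hpq, hoff p.1 _ r q hpq, hoff q.1 w s p hpq.symm,
    add_right_comm, hoff q.1 _ s p hpq.symm, hrest _ s p (Or.inl rfl)]
  have hR : 0 ≤ ∏ i ∈ (Finset.univ.erase p.1).erase q.1, f i w :=
    Finset.prod_nonneg fun i _ => h0 i w
  have := mul_nonneg (mul_nonneg (sub_nonneg.2 (hup p.1 s p hs))
    (sub_nonneg.2 (hup q.1 r q hr))) hR
  linarith

/-- A smooth approximation, as `k → ∞`, of the indicator of `{y | ∃ j, l (i, j) < y (i, j)}`. -/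
noncomputable def smoothRow (l : I × J → ℝ) (k : ℕ) (i : I) (y : I × J → ℝ) : ℝ :=
  1 - ∏ j, (1 - smoothTransition (k * y (i, j) - k * l (i, j)))

omit [Fintype I] [DecidableEq I] [DecidableEq J] in
lemma smoothRow_mem_Icc (l : I × J → ℝ) (k : ℕ) (i : I) (y : I × J → ℝ) :
    smoothRow l k i y ∈ Set.Icc (0 : ℝ) 1 := by
  have h0 : 0 ≤ ∏ j, (1 - smoothTransition (k * y (i, j) - k * l (i, j))) :=
    Finset.prod_nonneg fun j _ => sub_nonneg.2 (smoothTransition.le_one _)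
  have h1 : ∏ j, (1 - smoothTransition (k * y (i, j) - k * l (i, j))) ≤ 1 :=
    Finset.prod_le_one (fun j _ => sub_nonneg.2 (smoothTransition.le_one _))
      fun j _ => sub_le_self _ (smoothTransition.nonneg _)
  exact ⟨sub_nonneg.2 h1, sub_le_self _ h0⟩

omit [Fintype I] [DecidableEq I] [DecidableEq J] in
lemma smoothRow_monotone (l : I × J → ℝ) (k : ℕ) (i : I) : Monotone (smoothRow l k i) := by
  intro y y' h
  refine sub_le_sub_left (Finset.prod_le_prod
    (fun j _ => sub_nonneg.2 (smoothTransition.le_one _)) fun j _ => ?_) _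
  refine sub_le_sub_left (smoothTransition.monotone ?_) _
  have := h (i, j)
  gcongr

omit [DecidableEq I] [DecidableEq J] in
lemma smoothRow_hasBddDerivs (l : I × J → ℝ) (k : ℕ) (i : I) :
    HasBddDerivs (smoothRow l k i) := by
  refine (HasBddDerivs.const 1).sub (HasBddDerivs.prod _ fun j _ => (HasBddDerivs.const 1).sub ?_)
  exact (HasBddDerivs.smoothStep (k : ℝ) (k * l (i, j))).comp_clm
    (ContinuousLinearMap.proj (R := ℝ) (φ := fun _ : I × J => ℝ) (i, j))

omit [Fintype I] [DecidableEq I] [DecidableEq J] in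
open Classical in
lemma tendsto_smoothRow (l : I × J → ℝ) (i : I) (y : I × J → ℝ) :
    Filter.Tendsto (fun k => smoothRow l k i y) Filter.atTop
      (nhds (if ∃ j, l (i, j) < y (i, j) then 1 else 0)) := by
  have hj : ∀ j, Filter.Tendsto
      (fun k : ℕ => 1 - smoothTransition (k * y (i, j) - k * l (i, j))) Filter.atTop
      (nhds (if l (i, j) < y (i, j) then 0 else 1)) := by
    intro j
    split_ifs with h
    · refine tendsto_const_nhds.congr' ?_
      obtain ⟨N, hN⟩ := exists_nat_ge (1 / (y (i, j) - l (i, j)))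
      filter_upwards [Filter.eventually_ge_atTop N] with k hk
      have hpos : 0 < y (i, j) - l (i, j) := sub_pos.2 h
      have hk' : (N : ℝ) ≤ k := by exact_mod_cast hk
      have := (div_le_iff₀ hpos).1 (hN.trans hk')
      rw [smoothTransition.one_of_one_le (by linarith), sub_self]
    · refine tendsto_const_nhds.congr fun k => ?_
      have := mul_le_mul_of_nonneg_left (not_lt.1 h) (Nat.cast_nonneg (α := ℝ) k)
      rw [smoothTransition.zero_of_nonpos (by linarith), sub_zero]
  have h := (tendsto_finsetProd (Finset.univ : Finset J) fun j _ => hj j).const_sub 1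
  refine (Filter.tendsto_congr fun k => rfl).1 (h.trans (le_of_eq (congrArg nhds ?_)))
  split_ifs with hex
  · obtain ⟨j, hj⟩ := hex
    rw [Finset.prod_eq_zero (Finset.mem_univ j) (by simp [hj]), sub_zero]
  · push Not at hex
    rw [Finset.prod_eq_one fun j _ => by simp [hex j], sub_self]

/-- Gordon's comparison inequality, for processes whose covariances agree within each row. -/
theorem gaussian_minmax_comparison {μ ν : Measure (I × J → ℝ)} [IsGaussian μ] [IsGaussian ν]
    (hμ : μ[id] = 0) (hν : ν[id] = 0)
    (hsame : ∀ i j j', ∫ y, y (i, j) * y (i, j') ∂μ = ∫ y, y (i, j) * y (i, j') ∂ν)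
    (hdiff : ∀ p q : I × J, p.1 ≠ q.1 → ∫ y, y p * y q ∂ν ≤ ∫ y, y p * y q ∂μ)
    (l : I × J → ℝ) :
    ν {y | ∀ i, ∃ j, l (i, j) < y (i, j)} ≤ μ {y | ∀ i, ∃ j, l (i, j) < y (i, j)} := by
  classical
  set S : Set (I × J → ℝ) := {y | ∀ i, ∃ j, l (i, j) < y (i, j)} with hS
  have hSm : MeasurableSet S := by
    rw [hS]
    simp only [Set.ofPred_forall, Set.ofPred_exists]
    exact MeasurableSet.iInter fun i => MeasurableSet.iUnion fun j =>
      measurableSet_lt measurable_const (measurable_pi_apply _)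
  set F : ℕ → (I × J → ℝ) → ℝ := fun k y => ∏ i, smoothRow l k i y with hFdef
  have hF : ∀ k, HasBddDerivs (F k) := fun k =>
    HasBddDerivs.prod _ fun i _ => smoothRow_hasBddDerivs l k i
  have hle : ∀ k, ∫ y, F k y ∂ν ≤ ∫ y, F k y ∂μ := by
    intro k
    refine IsGaussian.integral_le_of_integral_fderiv_fderiv_le hμ hν (hF k) fun v => ?_
    have integrable_inner : ∀ (ρ : Measure (I × J → ℝ)) [IsGaussian ρ] (p q : I × J),
        Integrable (fun y => y p * y q) ρ := fun ρ _ p q => by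
      have hp := IsGaussian.memLp_dual ρ
        (ContinuousLinearMap.proj (R := ℝ) (φ := fun _ : I × J => ℝ) p) 2 (by simp)
      have hq := IsGaussian.memLp_dual ρ
        (ContinuousLinearMap.proj (R := ℝ) (φ := fun _ : I × J => ℝ) q) 2 (by simp)
      exact hp.integrable_mul hq
    have hexp : ∀ (ρ : Measure (I × J → ℝ)) [IsGaussian ρ],
        ∫ y, fderiv ℝ (fderiv ℝ (F k)) v y y ∂ρ = ∑ p, ∑ q,
          fderiv ℝ (fderiv ℝ (F k)) v (Pi.single p 1) (Pi.single q 1) *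
            ∫ y, y p * y q ∂ρ := fun ρ _ => by
      simp_rw [bilin_eq_sum_single (fderiv ℝ (fderiv ℝ (F k)) v)]
      rw [integral_finsetSum _ fun p _ => integrable_finsetSum _ fun q _ =>
        (integrable_inner ρ p q).const_mul _]
      refine Finset.sum_congr rfl fun p _ => ?_
      rw [integral_finsetSum _ fun q _ => (integrable_inner ρ p q).const_mul _]
      exact Finset.sum_congr rfl fun q _ => integral_const_mul _ _
    rw [hexp μ, hexp ν]
    refine Finset.sum_le_sum fun p _ => Finset.sum_le_sum fun q _ => ?_
    by_cases hpq : p.1 = q.1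
    · obtain ⟨i, j⟩ := p
      obtain ⟨i', j'⟩ := q
      obtain rfl : i = i' := hpq
      rw [hsame]
    · refine mul_le_mul_of_nonneg_left (hdiff p q hpq) ?_
      refine (hF k).fderiv_fderiv_nonneg _ _ _ fun w s r hs hr => ?_
      exact prod_supermodular_of_rows (fun i y => (smoothRow_mem_Icc l k i y).1)
        (fun i => smoothRow_monotone l k i)
        (fun i y y' h => by simp only [smoothRow, h]) hpq w hs hr
  have hlim : ∀ (ρ : Measure (I × J → ℝ)) [IsProbabilityMeasure ρ],
      Filter.Tendsto (fun k => ∫ y, F k y ∂ρ) Filter.atTop (nhds (ρ.real S)) := fun ρ _ => by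
    rw [← integral_indicator_one hSm]
    refine tendsto_integral_of_dominated_convergence (fun _ => 1)
      (fun k => (hF k).1.continuous.aestronglyMeasurable) (integrable_const _)
      (fun k => ae_of_all _ fun y => ?_) (ae_of_all _ fun y => ?_)
    · have h0 : 0 ≤ F k y := Finset.prod_nonneg fun i _ => (smoothRow_mem_Icc l k i y).1
      rw [Real.norm_eq_abs, abs_of_nonneg h0]
      exact Finset.prod_le_one (fun i _ => (smoothRow_mem_Icc l k i y).1)
        fun i _ => (smoothRow_mem_Icc l k i y).2
    · have h := tendsto_finsetProd (Finset.univ : Finset I) fun i _ => tendsto_smoothRow l i y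
      convert h using 2
      by_cases hy : y ∈ S
      · rw [Set.indicator_of_mem hy, Finset.prod_eq_one fun i _ => if_pos (hy i)]
        rfl
      · rw [Set.indicator_of_notMem hy]
        simp only [hS, Set.mem_ofPred_eq, not_forall] at hy
        obtain ⟨i, hi⟩ := hy
        exact (Finset.prod_eq_zero (Finset.mem_univ i) (if_neg hi)).symm
  have := le_of_tendsto_of_tendsto' (hlim ν) (hlim μ) hle
  exact (ENNReal.toReal_le_toReal (measure_ne_top _ _) (measure_ne_top _ _)).1 this

end Gordon

namespace ProbabilityTheory

section Prod

variable {E F : Type*} [NormedAddCommGroup E] [NormedSpace ℝ E] [CompleteSpace E]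
  [SecondCountableTopology E] [MeasurableSpace E] [BorelSpace E] [NormedAddCommGroup F]
  [NormedSpace ℝ F] [CompleteSpace F] [SecondCountableTopology F] [MeasurableSpace F]
  [BorelSpace F] {P : Measure E} {Q : Measure F} [IsGaussian P] [IsGaussian Q]

lemma integral_id_prod_eq_zero (hP : P[id] = 0) (hQ : Q[id] = 0) : (P.prod Q)[id] = 0 := by
  have hi : Integrable (id : E × F → E × F) (P.prod Q) := IsGaussian.integrable_id
  refine Prod.ext ?_ ?_
  · rw [fst_integral hi]
    simpa using (integral_fun_fst (μ := P) (ν := Q) (id : E → E)).trans (by simpa using hP)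
  · rw [snd_integral hi]
    simpa using (integral_fun_snd (μ := P) (ν := Q) (id : F → F)).trans (by simpa using hQ)

omit [CompleteSpace E] [SecondCountableTopology E] [CompleteSpace F] in
lemma covariance_coprod (L₁ M₁ : E →L[ℝ] ℝ) (L₂ M₂ : F →L[ℝ] ℝ) :
    cov[L₁.coprod L₂, M₁.coprod M₂; P.prod Q] = cov[L₁, M₁; P] + cov[L₂, M₂; Q] := by
  have h1 : ∀ L : E →L[ℝ] ℝ, MemLp L 2 P := fun L => IsGaussian.memLp_dual P L 2 (by simp)
  have h2 : ∀ L : F →L[ℝ] ℝ, MemLp L 2 Q := fun L => IsGaussian.memLp_dual Q L 2 (by simp)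
  have c1 : cov[fun z => L₁ z.1, fun z => M₁ z.1; P.prod Q] = cov[L₁, M₁; P] := by
    conv_rhs => rw [← (measurePreserving_fst (μ := P) (ν := Q)).map_eq]
    rw [covariance_map (by fun_prop) (by fun_prop) (by fun_prop)]
    rfl
  have c2 : cov[fun z => L₂ z.2, fun z => M₂ z.2; P.prod Q] = cov[L₂, M₂; Q] := by
    conv_rhs => rw [← (measurePreserving_snd (μ := P) (ν := Q)).map_eq]
    rw [covariance_map (by fun_prop) (by fun_prop) (by fun_prop)]
    rfl
  have c3 : cov[fun z => L₁ z.1, fun z => M₂ z.2; P.prod Q] = 0 :=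
    covariance_fst_snd_prod (h1 _) (h2 _)
  have c4 : cov[fun z => L₂ z.2, fun z => M₁ z.1; P.prod Q] = 0 := by
    rw [covariance_comm]
    exact covariance_fst_snd_prod (h1 _) (h2 _)
  have e : ∀ (L : E →L[ℝ] ℝ) (L' : F →L[ℝ] ℝ), (L.coprod L' : E × F → ℝ) =
      (fun z => L z.1) + fun z => L' z.2 := fun L L' => by ext; simp
  rw [e, e, covariance_add_left ((h1 _).comp_fst Q) ((h2 _).comp_snd P)
    (((h1 _).comp_fst Q).add ((h2 _).comp_snd P)),
    covariance_add_right ((h1 _).comp_fst Q) ((h1 _).comp_fst Q) ((h2 _).comp_snd P),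
    covariance_add_right ((h2 _).comp_snd P) ((h1 _).comp_fst Q) ((h2 _).comp_snd P),
    c1, c2, c3, c4]
  ring

end Prod

section Pi

variable {κ : Type*} [Fintype κ] {E : κ → Type*} [∀ k, NormedAddCommGroup (E k)]
  [∀ k, NormedSpace ℝ (E k)] [∀ k, CompleteSpace (E k)] [∀ k, SecondCountableTopology (E k)]
  [∀ k, MeasurableSpace (E k)] [∀ k, BorelSpace (E k)] {P : ∀ k, Measure (E k)}
  [∀ k, IsGaussian (P k)]

instance isGaussian_pi : IsGaussian (Measure.pi P) := by
  have hG : ∀ k, HasGaussianLaw (fun ω : ∀ k, E k => ω k) (Measure.pi P) := fun k => by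
    have hm : (Measure.pi P).map (fun ω => ω k) = P k := (measurePreserving_eval P k).map_eq
    have : IsGaussian ((Measure.pi P).map (fun ω => ω k)) := by rw [hm]; infer_instance
    exact IsGaussian.hasGaussianLaw
  have hind : iIndepFun (fun k (ω : ∀ k, E k) => ω k) (Measure.pi P) :=
    iIndepFun_pi (X := fun k => (id : E k → E k)) fun k => aemeasurable_id
  have := (hind.hasGaussianLaw hG).isGaussian_map
  simpa using this

lemma integral_id_pi_eq_zero (hP : ∀ k, (P k)[id] = 0) : (Measure.pi P)[id] = 0 := by
  ext k
  have hi : ∀ k, Integrable (fun ω : ∀ k, E k => id ω k) (Measure.pi P) := fun k =>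
    (measurePreserving_eval P k).integrable_comp_of_integrable
      (IsGaussian.integrable_id (μ := P k))
  rw [eval_integral hi]
  exact (integral_comp_eval (μ := P) (f := (id : E k → E k)) aestronglyMeasurable_id).trans (hP k)

omit [∀ k, CompleteSpace (E k)] [∀ k, SecondCountableTopology (E k)] in
lemma covariance_sum_comp_eval (L M : ∀ k, E k →L[ℝ] ℝ) :
    cov[fun ω => ∑ k, L k (ω k), fun ω => ∑ k, M k (ω k); Measure.pi P] =
      ∑ k, cov[L k, M k; P k] := by
  classical
  have h1 : ∀ k (L : E k →L[ℝ] ℝ), MemLp (fun ω : ∀ k, E k => L (ω k)) 2 (Measure.pi P) :=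
    fun k L => (IsGaussian.memLp_dual (P k) L 2 (by simp)).comp_measurePreserving
      (measurePreserving_eval P k)
  have hind : iIndepFun (fun k (ω : ∀ k, E k) => ω k) (Measure.pi P) :=
    iIndepFun_pi (X := fun k => (id : E k → E k)) fun k => aemeasurable_id
  rw [covariance_fun_sum_fun_sum (fun k => h1 k (L k)) (fun k => h1 k (M k))]
  refine Finset.sum_congr rfl fun k _ => ?_
  rw [Finset.sum_eq_single k]
  · conv_rhs => rw [← (measurePreserving_eval P k).map_eq]
    rw [covariance_map (by fun_prop) (by fun_prop) (measurable_pi_apply k).aemeasurable]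
    rfl
  · intro j _ hj
    exact ((hind.indepFun hj.symm).comp (L k).measurable
      (M j).measurable).covariance_eq_zero (h1 _ _) (h1 _ _)
  · simp

end Pi

end ProbabilityTheory

section Comparison

variable {E : Type*} [NormedAddCommGroup E] [NormedSpace ℝ E] [CompleteSpace E]
  [SecondCountableTopology E] [MeasurableSpace E] [BorelSpace E] {P : Measure E} [IsGaussian P]
  {I J : Type*} [Fintype I] [Fintype J]

lemma integral_id_map_eq_zero (hP : P[id] = 0) (Y : E →L[ℝ] (I × J → ℝ)) :
    (P.map Y)[id] = 0 := by
  rw [integral_map (by fun_prop) (by fun_prop)]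
  have := Y.integral_comp_comm (IsGaussian.integrable_id (μ := P))
  simp only [id] at this hP ⊢
  rw [this, hP, map_zero]

lemma integral_mul_map_pi (hP : P[id] = 0) (Y : I × J → E →L[ℝ] ℝ) (p q : I × J) :
    ∫ y, y p * y q ∂(P.map (ContinuousLinearMap.pi Y)) = cov[Y p, Y q; P] := by
  have h0 : ∀ p, ∫ x, Y p x ∂P = 0 := fun p => by
    rw [IsGaussian.integral_dual]
    simp only [id] at hP
    rw [hP, map_zero]
  rw [integral_map (by fun_prop) (by fun_prop),
    covariance_eq_sub (IsGaussian.memLp_dual P _ 2 (by simp))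
      (IsGaussian.memLp_dual P _ 2 (by simp)), h0, h0]
  simp

theorem gaussian_minmax_comparison_of_covariance (hP : P[id] = 0) (Y W : I × J → E →L[ℝ] ℝ)
    (hsame : ∀ i j j', cov[Y (i, j), Y (i, j'); P] = cov[W (i, j), W (i, j'); P])
    (hdiff : ∀ p q : I × J, p.1 ≠ q.1 → cov[W p, W q; P] ≤ cov[Y p, Y q; P]) (l : I × J → ℝ) :
    P {ω | ∃ i, ∀ j, Y (i, j) ω ≤ l (i, j)} ≤ P {ω | ∃ i, ∀ j, W (i, j) ω ≤ l (i, j)} := by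
  classical
  have hm : MeasurableSet {y : I × J → ℝ | ∀ i, ∃ j, l (i, j) < y (i, j)} := by
    simp only [Set.ofPred_forall, Set.ofPred_exists]
    exact MeasurableSet.iInter fun i => MeasurableSet.iUnion fun j =>
      measurableSet_lt measurable_const (measurable_pi_apply _)
  have key : ∀ X : I × J → E →L[ℝ] ℝ, P {ω | ∃ i, ∀ j, X (i, j) ω ≤ l (i, j)} =
      1 - P.map (ContinuousLinearMap.pi X) {y | ∀ i, ∃ j, l (i, j) < y (i, j)} := fun X => by
    have hX : Measurable (ContinuousLinearMap.pi X) := by fun_prop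
    rw [Measure.map_apply hX hm, ← prob_compl_eq_one_sub (hX hm)]
    congr 1
    ext ω
    simp
  rw [key, key]
  refine tsub_le_tsub_left (gaussian_minmax_comparison (integral_id_map_eq_zero hP _)
    (integral_id_map_eq_zero hP _) (fun i j j' => ?_) (fun p q hpq => ?_) l) 1
  · simpa only [integral_mul_map_pi hP] using hsame i j j'
  · simpa only [integral_mul_map_pi hP] using hdiff p q hpq

end Comparison

lemma covariance_dual_gaussianReal (L M : ℝ →L[ℝ] ℝ) :
    cov[L, M; gaussianReal 0 1] = L 1 * M 1 := by
  have h : ∀ L : ℝ →L[ℝ] ℝ, ⇑L = fun x => L 1 * id x := fun L => by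
    ext x
    simpa [mul_comm] using L.map_smul x 1
  rw [h L, h M, covariance_const_mul_left, covariance_const_mul_right,
    covariance_self aemeasurable_id, variance_id_gaussianReal]
  simp

/-- The continuous linear functional `x ↦ ∑ i, a i * x i`. -/
noncomputable def vecFunctional {k : ℕ} (a : Fin k → ℝ) : (Fin k → ℝ) →L[ℝ] ℝ :=
  ∑ i, (a i • ContinuousLinearMap.id ℝ ℝ).comp (ContinuousLinearMap.proj i)

lemma vecFunctional_apply {k : ℕ} (a x : Fin k → ℝ) : vecFunctional a x = ∑ i, a i * x i := by
  simp [vecFunctional]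

/-- The continuous linear functional `G ↦ ∑ k, ∑ i, A k i * G k i`. -/
noncomputable def matFunctional {m n : ℕ} (A : Fin m → Fin n → ℝ) :
    (Fin m → Fin n → ℝ) →L[ℝ] ℝ :=
  ∑ k, (vecFunctional (A k)).comp (ContinuousLinearMap.proj k)

lemma matFunctional_apply {m n : ℕ} (A G : Fin m → Fin n → ℝ) :
    matFunctional A G = ∑ k, ∑ i, A k i * G k i := by
  simp [matFunctional, vecFunctional_apply]

instance isGaussian_stdVec (k : ℕ) : IsGaussian (stdVec k) := by
  unfold stdVec; infer_instance

instance isGaussian_stdMat (m n : ℕ) : IsGaussian (stdMat m n) := by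
  unfold stdMat; infer_instance

lemma integral_id_stdVec (k : ℕ) : (stdVec k)[id] = 0 :=
  integral_id_pi_eq_zero fun _ => integral_id_gaussianReal

lemma integral_id_stdMat (m n : ℕ) : (stdMat m n)[id] = 0 :=
  integral_id_pi_eq_zero fun _ => integral_id_stdVec n

lemma covariance_vecFunctional {k : ℕ} (a b : Fin k → ℝ) :
    cov[vecFunctional a, vecFunctional b; stdVec k] = ∑ i, a i * b i := by
  have h : ∀ a : Fin k → ℝ, ⇑(vecFunctional a) =
      fun x => ∑ i, (a i • ContinuousLinearMap.id ℝ ℝ) (x i) := fun a => by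
    ext; simp [vecFunctional_apply]
  rw [h, h, stdVec, covariance_sum_comp_eval]
  exact Finset.sum_congr rfl fun i _ => by
    rw [covariance_dual_gaussianReal]; simp

lemma covariance_matFunctional {m n : ℕ} (A B : Fin m → Fin n → ℝ) :
    cov[matFunctional A, matFunctional B; stdMat m n] = ∑ k, ∑ i, A k i * B k i := by
  have h : ∀ A : Fin m → Fin n → ℝ, ⇑(matFunctional A) =
      fun G => ∑ k, vecFunctional (A k) (G k) := fun a => by
    ext; simp [matFunctional_apply, vecFunctional_apply]
  rw [h, h, stdMat, covariance_sum_comp_eval]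
  exact Finset.sum_congr rfl fun k _ => covariance_vecFunctional _ _

/-- The linear functional of `(G, (g, (f, (h, (z, z̃)))))` with the given coefficients. -/
noncomputable def sampleFunctional {m n : ℕ} (A : Fin m → Fin n → ℝ) (b b' : Fin m → ℝ)
    (η : Fin n → ℝ) (c c' : ℝ) :
    ((Fin m → Fin n → ℝ) × ((Fin m → ℝ) × ((Fin m → ℝ) × ((Fin n → ℝ) × (ℝ × ℝ))))) →L[ℝ] ℝ :=
  (matFunctional A).coprod ((vecFunctional b).coprod ((vecFunctional b').coprod
    ((vecFunctional η).coprod ((c • ContinuousLinearMap.id ℝ ℝ).coprod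
      (c' • ContinuousLinearMap.id ℝ ℝ)))))

lemma covariance_sampleFunctional {m n : ℕ} (A B : Fin m → Fin n → ℝ) (b₁ b₂ d₁ d₂ : Fin m → ℝ)
    (η ξ : Fin n → ℝ) (c₁ c₂ e₁ e₂ : ℝ) :
    cov[sampleFunctional A b₁ b₂ η c₁ c₂, sampleFunctional B d₁ d₂ ξ e₁ e₂;
      (stdMat m n).prod ((stdVec m).prod ((stdVec m).prod ((stdVec n).prod
        ((gaussianReal 0 1).prod (gaussianReal 0 1)))))] =
      ∑ k, ∑ i, A k i * B k i + (∑ k, b₁ k * d₁ k + (∑ k, b₂ k * d₂ k +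
        (∑ i, η i * ξ i + (c₁ * e₁ + c₂ * e₂)))) := by
  simp only [sampleFunctional]
  rw [covariance_coprod, covariance_coprod, covariance_coprod, covariance_coprod,
    covariance_coprod, covariance_matFunctional, covariance_vecFunctional,
    covariance_vecFunctional, covariance_vecFunctional, covariance_dual_gaussianReal,
    covariance_dual_gaussianReal]
  simp

lemma integral_id_sample (m n : ℕ) :
    ((stdMat m n).prod ((stdVec m).prod ((stdVec m).prod ((stdVec n).prod
      ((gaussianReal 0 1).prod (gaussianReal 0 1))))))[id] = 0 :=
  integral_id_prod_eq_zero (integral_id_stdMat m n)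
    (integral_id_prod_eq_zero (integral_id_stdVec m)
      (integral_id_prod_eq_zero (integral_id_stdVec m)
        (integral_id_prod_eq_zero (integral_id_stdVec n)
          (integral_id_prod_eq_zero integral_id_gaussianReal integral_id_gaussianReal))))

lemma sampleFunctional_apply {m n : ℕ} (A : Fin m → Fin n → ℝ) (b b' : Fin m → ℝ)
    (η : Fin n → ℝ) (c c' : ℝ)
    (ω : (Fin m → Fin n → ℝ) × ((Fin m → ℝ) × ((Fin m → ℝ) × ((Fin n → ℝ) × (ℝ × ℝ))))) :
    sampleFunctional A b b' η c c' ω = ∑ k, ∑ i, A k i * ω.1 k i + (∑ k, b k * ω.2.1 k +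
      (∑ k, b' k * ω.2.2.1 k + (∑ i, η i * ω.2.2.2.1 i +
        (c * ω.2.2.2.2.1 + c' * ω.2.2.2.2.2)))) := by
  simp [sampleFunctional, matFunctional_apply, vecFunctional_apply]

lemma dotp_comm {k : ℕ} (a b : Fin k → ℝ) : dotp a b = dotp b a := by
  simp [dotp, mul_comm]

lemma dotp_self {k : ℕ} (a : Fin k → ℝ) : dotp a a = nrm a ^ 2 := by
  rw [nrm, sq_sqrt (Finset.sum_nonneg fun i _ => sq_nonneg _)]
  simp [dotp, sq]

lemma dotp_le {k : ℕ} (a b : Fin k → ℝ) : dotp a b ≤ nrm a * nrm b :=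
  sum_mul_le_sqrt_mul_sqrt _ _ _

lemma abs_dotp_le {k : ℕ} (a b : Fin k → ℝ) : |dotp a b| ≤ nrm a * nrm b := by
  refine abs_le'.2 ⟨dotp_le a b, ?_⟩
  have h : nrm (-a) = nrm a := by simp [nrm]
  simpa [h, dotp] using dotp_le (-a) b

lemma nrm_Zv {n : ℕ} (L : ℝ) {x : Fin n → ℝ} (hx : ∀ i, x i ≠ 0) :
    nrm (Zv L x) = √(∑ _i : Fin n, L ^ 2) := by
  unfold nrm Zv
  congr 1
  refine Finset.sum_congr rfl fun i _ => ?_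
  rcases (hx i).lt_or_gt with h | h
  · simp [sign_of_neg h]
  · simp [sign_of_pos h]

lemma dotp_xr_Zv_le {n : ℕ} {L r : ℝ} (hL : 0 < L) {x y : Fin n → ℝ} (hx : ∀ i, x i ≠ 0)
    (hx' : ∀ i, x i ∉ Set.Ioo (-(L * r)) (L * r)) :
    dotp (xr L r x) (Zv L y) ≤ dotp (xr L r x) (Zv L x) := by
  refine Finset.sum_le_sum fun i _ => ?_
  have hy : Real.sign (y i) ≤ 1 ∧ -1 ≤ Real.sign (y i) := by
    rcases sign_apply_eq (y i) with h | h | h <;> rw [h] <;> norm_num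
  have hi := hx' i
  simp only [Set.mem_Ioo, not_and, not_lt] at hi
  simp only [xr, Zv]
  rcases (hx i).lt_or_gt with h | h
  · rw [sign_of_neg h]
    have : x i ≤ -(L * r) := by
      by_contra! h'
      nlinarith [hi h', mul_pos hL (show 0 < r by nlinarith)]
    nlinarith [mul_nonneg (mul_nonneg hL.le (sub_nonneg.2 this)) (sub_nonneg.2 hy.2)]
  · rw [sign_of_pos h]
    have : L * r ≤ x i := by
      by_contra! h'
      have := hi (by nlinarith)
      linarith
    nlinarith [mul_nonneg (mul_nonneg hL.le (sub_nonneg.2 this)) (sub_nonneg.2 hy.1)]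

instance isGaussian_sample (m n : ℕ) : IsGaussian ((stdMat m n).prod
    ((stdVec m).prod ((stdVec m).prod ((stdVec n).prod
      ((gaussianReal 0 1).prod (gaussianReal 0 1)))))) := by
  have h₁ : IsGaussian ((gaussianReal 0 1).prod (gaussianReal 0 1)) := inferInstance
  have h₂ : IsGaussian ((stdVec n).prod ((gaussianReal 0 1).prod (gaussianReal 0 1))) :=
    inferInstance
  have h₃ : IsGaussian ((stdVec m).prod ((stdVec n).prod
    ((gaussianReal 0 1).prod (gaussianReal 0 1)))) := inferInstance
  have h₄ : IsGaussian ((stdVec m).prod ((stdVec m).prod ((stdVec n).prod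
    ((gaussianReal 0 1).prod (gaussianReal 0 1))))) := inferInstance
  infer_instance

variable {m n : ℕ}

/-- The process with a matrix part, as a linear functional of the sample. -/
noncomputable def matrixProcess (θ ν : ℝ) (a b : Fin n → ℝ) (u : Fin m → ℝ) (γ : ℝ) :
    ((Fin m → Fin n → ℝ) × ((Fin m → ℝ) × ((Fin m → ℝ) × ((Fin n → ℝ) × (ℝ × ℝ))))) →L[ℝ] ℝ :=
  sampleFunctional (fun k i => u k * (a i + γ * b i)) 0 0 0
    (nrm u * nrm a + |γ| * θ * nrm u * nrm b) (|γ| * ν * nrm u * nrm b)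

/-- The process with a vector part only, as a linear functional of the sample. -/
noncomputable def vectorProcess (θ ν : ℝ) (a b : Fin n → ℝ) (u : Fin m → ℝ) (γ : ℝ) :
    ((Fin m → Fin n → ℝ) × ((Fin m → ℝ) × ((Fin m → ℝ) × ((Fin n → ℝ) × (ℝ × ℝ))))) →L[ℝ] ℝ :=
  sampleFunctional 0 (fun k => (nrm a + γ * nrm b * θ) * u k) (fun k => γ * nrm b * ν * u k)
    (fun i => -(nrm u * (a i + |γ| * b i))) 0 0

lemma matrixProcess_apply (θ ν : ℝ) (a b : Fin n → ℝ) (u : Fin m → ℝ) (γ : ℝ)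
    (ω : (Fin m → Fin n → ℝ) × ((Fin m → ℝ) × ((Fin m → ℝ) × ((Fin n → ℝ) × (ℝ × ℝ))))) :
    matrixProcess θ ν a b u γ ω =
      dotp u (mulV ω.1 a) + γ * dotp u (mulV ω.1 b) + ω.2.2.2.2.1 * nrm u * nrm a +
        |γ| * (θ * ω.2.2.2.2.1 + ν * ω.2.2.2.2.2) * nrm u * nrm b := by
  have h : ∑ k, ∑ i, u k * (a i + γ * b i) * ω.1 k i =
      dotp u (mulV ω.1 a) + γ * dotp u (mulV ω.1 b) := by
    simp only [dotp, mulV, Finset.mul_sum, ← Finset.sum_add_distrib]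
    exact Finset.sum_congr rfl fun k _ => Finset.sum_congr rfl fun i _ => by ring
  rw [matrixProcess, sampleFunctional_apply, h]
  simp
  ring

lemma vectorProcess_apply (θ ν : ℝ) (a b : Fin n → ℝ) (u : Fin m → ℝ) (γ : ℝ)
    (ω : (Fin m → Fin n → ℝ) × ((Fin m → ℝ) × ((Fin m → ℝ) × ((Fin n → ℝ) × (ℝ × ℝ))))) :
    vectorProcess θ ν a b u γ ω =
      nrm a * dotp ω.2.1 u - nrm u * dotp ω.2.2.2.1 a +
        γ * nrm b * dotp (fun k => θ * ω.2.1 k + ν * ω.2.2.1 k) u -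
        |γ| * nrm u * dotp ω.2.2.2.1 b := by
  have h₁ : ∀ (c : ℝ) (g : Fin m → ℝ), ∑ k, c * u k * g k = c * dotp g u := fun c g => by
    simp only [dotp, Finset.mul_sum]
    exact Finset.sum_congr rfl fun k _ => by ring
  have h₂ : ∑ i, -(nrm u * (a i + |γ| * b i)) * ω.2.2.2.1 i =
      -(nrm u * (dotp ω.2.2.2.1 a + |γ| * dotp ω.2.2.2.1 b)) := by
    simp only [dotp, Finset.mul_sum, ← Finset.sum_add_distrib, ← Finset.sum_neg_distrib]
    exact Finset.sum_congr rfl fun k _ => by ring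
  have h₃ : dotp (fun k => θ * ω.2.1 k + ν * ω.2.2.1 k) u =
      θ * dotp ω.2.1 u + ν * dotp ω.2.2.1 u := by
    simp only [dotp, Finset.mul_sum, ← Finset.sum_add_distrib]
    exact Finset.sum_congr rfl fun k _ => by ring
  rw [vectorProcess, sampleFunctional_apply, h₁, h₁, h₂, h₃]
  simp
  ring

lemma covariance_matrixProcess (θ ν : ℝ) (a b a' b' : Fin n → ℝ) (u u' : Fin m → ℝ) (γ γ' : ℝ) :
    cov[matrixProcess θ ν a b u γ, matrixProcess θ ν a' b' u' γ';
      (stdMat m n).prod ((stdVec m).prod ((stdVec m).prod ((stdVec n).prod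
        ((gaussianReal 0 1).prod (gaussianReal 0 1)))))] =
      dotp u u' * (dotp a a' + γ' * dotp a b' + γ * dotp b a' + γ * γ' * dotp b b') +
        (nrm u * nrm a + |γ| * θ * nrm u * nrm b) *
          (nrm u' * nrm a' + |γ'| * θ * nrm u' * nrm b') +
        |γ| * ν * nrm u * nrm b * (|γ'| * ν * nrm u' * nrm b') := by
  have h : ∑ k, ∑ i, u k * (a i + γ * b i) * (u' k * (a' i + γ' * b' i)) =
      dotp u u' * (dotp a a' + γ' * dotp a b' + γ * dotp b a' + γ * γ' * dotp b b') := by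
    simp only [dotp, Finset.mul_sum, ← Finset.sum_add_distrib, Finset.sum_mul]
    rw [Finset.sum_comm]
    exact Finset.sum_congr rfl fun k _ => Finset.sum_congr rfl fun i _ => by ring
  rw [matrixProcess, matrixProcess, covariance_sampleFunctional, h]
  simp
  ring

lemma covariance_vectorProcess (θ ν : ℝ) (a b a' b' : Fin n → ℝ) (u u' : Fin m → ℝ) (γ γ' : ℝ) :
    cov[vectorProcess θ ν a b u γ, vectorProcess θ ν a' b' u' γ';
      (stdMat m n).prod ((stdVec m).prod ((stdVec m).prod ((stdVec n).prod
        ((gaussianReal 0 1).prod (gaussianReal 0 1)))))] =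
      (nrm a + γ * nrm b * θ) * (nrm a' + γ' * nrm b' * θ) * dotp u u' +
        γ * nrm b * ν * (γ' * nrm b' * ν) * dotp u u' +
        nrm u * nrm u' *
          (dotp a a' + |γ'| * dotp a b' + |γ| * dotp b a' + |γ| * |γ'| * dotp b b') := by
  have h₁ : ∀ c c' : ℝ, ∑ k, c * u k * (c' * u' k) = c * c' * dotp u u' := fun c c' => by
    simp only [dotp, Finset.mul_sum]
    exact Finset.sum_congr rfl fun k _ => by ring
  have h₂ : ∑ i, -(nrm u * (a i + |γ| * b i)) * -(nrm u' * (a' i + |γ'| * b' i)) =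
      nrm u * nrm u' *
        (dotp a a' + |γ'| * dotp a b' + |γ| * dotp b a' + |γ| * |γ'| * dotp b b') := by
    simp only [dotp, Finset.mul_sum, ← Finset.sum_add_distrib]
    exact Finset.sum_congr rfl fun k _ => by ring
  rw [vectorProcess, vectorProcess, covariance_sampleFunctional, h₁, h₁, h₂]
  simp
  ring

/-- For a fixed row the two processes have the same covariance. -/
lemma covariance_matrixProcess_eq {θ ν : ℝ} (hν : θ ^ 2 + ν ^ 2 = 1) {a b : Fin n → ℝ}
    (hab : dotp a b = θ * (nrm a * nrm b)) (u u' : Fin m → ℝ) (γ γ' : ℝ) :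
    cov[matrixProcess θ ν a b u γ, matrixProcess θ ν a b u' γ';
      (stdMat m n).prod ((stdVec m).prod ((stdVec m).prod ((stdVec n).prod
        ((gaussianReal 0 1).prod (gaussianReal 0 1)))))] =
    cov[vectorProcess θ ν a b u γ, vectorProcess θ ν a b u' γ';
      (stdMat m n).prod ((stdVec m).prod ((stdVec m).prod ((stdVec n).prod
        ((gaussianReal 0 1).prod (gaussianReal 0 1)))))] := by
  rw [covariance_matrixProcess, covariance_vectorProcess, dotp_self, dotp_self, dotp_comm b a, hab]
  linear_combination (|γ| * |γ'| * nrm u * nrm u' - γ * γ' * dotp u u') * nrm b ^ 2 * hν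

lemma covariance_vectorProcess_le {θ ν : ℝ} (hν : θ ^ 2 + ν ^ 2 = 1) {a b a' b' : Fin n → ℝ}
    (hab : dotp a b' ≤ θ * (nrm a * nrm b')) (hba : dotp b a' ≤ θ * (nrm b * nrm a'))
    (u u' : Fin m → ℝ) (γ γ' : ℝ) :
    cov[vectorProcess θ ν a b u γ, vectorProcess θ ν a' b' u' γ';
      (stdMat m n).prod ((stdVec m).prod ((stdVec m).prod ((stdVec n).prod
        ((gaussianReal 0 1).prod (gaussianReal 0 1)))))] ≤
    cov[matrixProcess θ ν a b u γ, matrixProcess θ ν a' b' u' γ';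
      (stdMat m n).prod ((stdVec m).prod ((stdVec m).prod ((stdVec n).prod
        ((gaussianReal 0 1).prod (gaussianReal 0 1)))))] := by
  have key : ∀ c : ℝ, 0 ≤ nrm u * nrm u' * |c| - c * dotp u u' := fun c => by
    have := mul_le_mul_of_nonneg_left (abs_dotp_le u u') (abs_nonneg c)
    rw [← abs_mul] at this
    linarith [le_abs_self (c * dotp u u')]
  have h₁ := mul_nonneg (key 1) (sub_nonneg.2 (dotp_le a a'))
  have h₂ := mul_nonneg (key γ') (sub_nonneg.2 hab)
  have h₃ := mul_nonneg (key γ) (sub_nonneg.2 hba)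
  have h₄ := mul_nonneg (key (γ * γ')) (sub_nonneg.2 (dotp_le b b'))
  rw [abs_one] at h₁
  rw [abs_mul] at h₄
  rw [covariance_matrixProcess, covariance_vectorProcess]
  have hν' : ν ^ 2 = 1 - θ ^ 2 := by linarith
  have e : (|γ| * |γ'| * nrm u * nrm u' - γ * γ' * dotp u u') * (nrm b * nrm b') *
      (θ ^ 2 + ν ^ 2 - 1) = 0 := by rw [hν]; ring
  linarith

end GaussianComparison

/-- the Gaussian comparison inequality over finite sets.  The sample
`ω = (G, (g, (f, (h, (z, z̃)))))` consists of independent standard Gaussians; the event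
`{minmax ≤ t}` is expressed as `∃ (x, d), ∀ (u, γ), process ≤ t`. -/
theorem stmt9 (m n : ℕ) (L r θ t : ℝ) (hL : 0 < L) (hr : 0 < r)
    (hθ : -1 ≤ θ) (hθ' : θ ≤ 1)
    (Ix : Set (Fin n → ℝ)) (hIxfin : Ix.Finite)
    (hIx : ∀ x ∈ Ix, (∀ i, x i ≠ 0) ∧ (∀ i, x i ∉ Set.Ioo (-(L * r)) (L * r)) ∧
      dotp (xr L r x) (Zv L x) = θ * (nrm (xr L r x) * nrm (Zv L x)))
    (Iu Id : Set (Fin m → ℝ)) (hIu : Iu.Finite) (hId : Id.Finite)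
    (Iγ : Set ℝ) (hIγ : Iγ.Finite)
    (ψ : (Fin m → ℝ) → (Fin n → ℝ) → (Fin m → ℝ) → ℝ → ℝ) :
    ((stdMat m n).prod
        ((stdVec m).prod ((stdVec m).prod ((stdVec n).prod
          ((gaussianReal 0 1).prod (gaussianReal 0 1))))))
        {ω : (Fin m → Fin n → ℝ) ×
            ((Fin m → ℝ) × ((Fin m → ℝ) × ((Fin n → ℝ) × (ℝ × ℝ)))) |
          ∃ x ∈ Ix, ∃ d ∈ Id, ∀ u ∈ Iu, ∀ γ ∈ Iγ,
            dotp u (mulV ω.1 (xr L r x)) + γ * dotp u (mulV ω.1 (Zv L x)) +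
              ω.2.2.2.2.1 * nrm u * nrm (xr L r x) +
              |γ| * (θ * ω.2.2.2.2.1 + Real.sqrt (1 - θ ^ 2) * ω.2.2.2.2.2) *
                nrm u * nrm (Zv L x) +
              ψ d x u γ ≤ t} ≤
      ((stdMat m n).prod
        ((stdVec m).prod ((stdVec m).prod ((stdVec n).prod
          ((gaussianReal 0 1).prod (gaussianReal 0 1))))))
        {ω : (Fin m → Fin n → ℝ) ×
            ((Fin m → ℝ) × ((Fin m → ℝ) × ((Fin n → ℝ) × (ℝ × ℝ)))) |
          ∃ x ∈ Ix, ∃ d ∈ Id, ∀ u ∈ Iu, ∀ γ ∈ Iγ,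
            nrm (xr L r x) * dotp ω.2.1 u - nrm u * dotp ω.2.2.2.1 (xr L r x) +
              γ * nrm (Zv L x) *
                dotp (fun k => θ * ω.2.1 k + Real.sqrt (1 - θ ^ 2) * ω.2.2.1 k) u -
              |γ| * nrm u * dotp ω.2.2.2.1 (Zv L x) + ψ d x u γ ≤ t} := by
  classical
  have := hIxfin.fintype
  have := hIu.fintype
  have := hId.fintype
  have := hIγ.fintype
  have hν : θ ^ 2 + √(1 - θ ^ 2) ^ 2 = 1 := by
    rw [sq_sqrt (by nlinarith)]; ring
  have hle : ∀ x ∈ Ix, ∀ y ∈ Ix, dotp (xr L r x) (Zv L y) ≤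
      θ * (nrm (xr L r x) * nrm (Zv L y)) := fun x hx y hy => by
    rw [nrm_Zv L (hIx y hy).1, ← nrm_Zv L (hIx x hx).1, ← (hIx x hx).2.2]
    exact dotp_xr_Zv_le hL (hIx x hx).1 (hIx x hx).2.1
  have key := gaussian_minmax_comparison_of_covariance (integral_id_sample m n)
    (fun p : (Ix × Id) × (Iu × Iγ) => matrixProcess θ √(1 - θ ^ 2) (xr L r p.1.1) (Zv L p.1.1)
      p.2.1 p.2.2)
    (fun p : (Ix × Id) × (Iu × Iγ) => vectorProcess θ √(1 - θ ^ 2) (xr L r p.1.1) (Zv L p.1.1)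
      p.2.1 p.2.2)
    (fun i j j' => covariance_matrixProcess_eq hν (hIx _ i.1.2).2.2 _ _ _ _)
    (fun p q _ => covariance_vectorProcess_le hν (hle _ p.1.1.2 _ q.1.1.2)
      (by rw [dotp_comm, mul_comm (nrm _)]; exact hle _ q.1.1.2 _ p.1.1.2) _ _ _ _)
    (fun p => t - ψ p.1.2 p.1.1 p.2.1 p.2.2)
  simp only [matrixProcess_apply, vectorProcess_apply, le_sub_iff_add_le] at key
  simpa only [Prod.exists, Prod.forall, Subtype.exists, Subtype.forall, exists_prop,
    exists_and_left] using key
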